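/- arXiv:1811.07105 — 2 statements merged into one kernel-verified Lean document; each statement's English description precedes it below -/
import Mathlib

section
/- In the dense regime of the sparse positive-dependence detection problem, the hypotheses merge asymptotically: if ε_n = n^{-β} with β ∈ (0,1) fixed and ρ_n = n^{-γ} with γ > 0 fixed such that γ > 1/2 − β, then the total variation distance between the n-fold product measure of N(0,Σ_0) and the n-fold product measure of P_{ε_n,ρ_n} tends to 0 as n → ∞; consequently every sequence of tests (in particular the likelihood ratio test) is asymptotically powerless. -/
open MeasureTheory ProbabilityTheory Real Filter Topology

noncomputable section

/-- The standard normal distribution on ℝ. -/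
def stdGauss : Measure ℝ := gaussianReal 0 1

/-- Two independent standard normals. -/
def stdGauss2 : Measure (ℝ × ℝ) := stdGauss.prod stdGauss

/-- `N(0, Σ_ρ)`: the centered bivariate normal with unit marginal variances and
correlation `ρ`, i.e. the law of `(Z₁, ρ Z₁ + √(1-ρ²) Z₂)` for independent standard
normal `Z₁, Z₂`. -/
def biNormal (ρ : ℝ) : Measure (ℝ × ℝ) :=
  stdGauss2.map fun z => (z.1, ρ * z.1 + Real.sqrt (1 - ρ ^ 2) * z.2)

/-- The contamination mixture `P_{ε,ρ} = (1-ε) N(0,Σ₀) + ε N(0,Σ_ρ)`. -/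
def mixture (ε ρ : ℝ) : Measure (ℝ × ℝ) :=
  ENNReal.ofReal (1 - ε) • biNormal 0 + ENNReal.ofReal ε • biNormal ρ

/-- The `n`-fold product (i.i.d.) measure. -/
def iid (n : ℕ) (μ : Measure (ℝ × ℝ)) : Measure (Fin n → ℝ × ℝ) :=
  Measure.pi fun _ => μ

/-- Total variation distance between two measures. -/
def tvDist {Ω : Type*} [MeasurableSpace Ω] (μ ν : Measure Ω) : ℝ :=
  ⨆ s : {s : Set Ω // MeasurableSet s}, |(μ s.1).toReal - (ν s.1).toReal|

section ChiSquareBound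

variable {X : Type*} [MeasurableSpace X]

theorem pi_withDensity_eq {n : ℕ} (Q : Measure X) [IsProbabilityMeasure Q] {f : X → ℝ}
    (hf0 : ∀ x, 0 ≤ f x) (hfi : Integrable f Q)
    [IsProbabilityMeasure (Q.withDensity fun x => ENNReal.ofReal (f x))] :
    (Measure.pi fun _ : Fin n => Q.withDensity fun x => ENNReal.ofReal (f x)) =
      (Measure.pi fun _ : Fin n => Q).withDensity fun x => ENNReal.ofReal (∏ i, f (x i)) := by
  refine Measure.pi_eq fun s hs => ?_
  have hind : ∀ (i : Fin n), Integrable ((s i).indicator f) Q := fun i => hfi.indicator (hs i)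
  have hnn : ∀ (i : Fin n) (x : X), 0 ≤ (s i).indicator f x :=
    fun i x => Set.indicator_nonneg (fun _ _ => hf0 _) x
  have hprod : (Set.univ.pi s).indicator (fun x : Fin n → X => ENNReal.ofReal (∏ i, f (x i))) =
      fun x => ENNReal.ofReal (∏ i, (s i).indicator f (x i)) := by
    ext x
    by_cases hx : x ∈ Set.univ.pi s
    · rw [Set.indicator_of_mem hx]
      congr 1
      refine Finset.prod_congr rfl fun i _ => ?_
      rw [Set.indicator_of_mem (hx i (Set.mem_univ i))]
    · rw [Set.indicator_of_notMem hx]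
      simp only [Set.mem_univ_pi, not_forall] at hx
      obtain ⟨i, hi⟩ := hx
      rw [Finset.prod_eq_zero (Finset.mem_univ i) (Set.indicator_of_notMem hi f),
        ENNReal.ofReal_zero]
  rw [withDensity_apply _ (MeasurableSet.univ_pi hs),
    ← lintegral_indicator (MeasurableSet.univ_pi hs), hprod,
    ← ofReal_integral_eq_lintegral_ofReal (Integrable.fintype_prod hind)
      (ae_of_all _ fun x => Finset.prod_nonneg fun i _ => hnn i (x i)),
    integral_fintype_prod_eq_prod (fun i => (s i).indicator f),
    ENNReal.ofReal_prod_of_nonneg fun i _ => integral_nonneg (hnn i)]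
  refine Finset.prod_congr rfl fun i _ => ?_
  rw [withDensity_apply _ (hs i),
    ofReal_integral_eq_lintegral_ofReal (hind i) (ae_of_all _ (hnn i)),
    ← lintegral_indicator (hs i)]
  refine lintegral_congr fun x => ?_
  by_cases hx : x ∈ s i <;> simp [hx]

theorem abs_sub_withDensity_le (Q : Measure X) [IsProbabilityMeasure Q] {F : X → ℝ}
    (hF : Measurable F) (hF0 : ∀ x, 0 ≤ F x) (hF1 : ∫ x, F x ∂Q = 1)
    (hF2 : Integrable (fun x => F x ^ 2) Q) {A : Set X} (hA : MeasurableSet A) :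
    |(Q A).toReal - ((Q.withDensity fun x => ENNReal.ofReal (F x)) A).toReal| ≤
      √((∫ x, F x ^ 2 ∂Q) - 1) := by
  have hL2 : MemLp F 2 Q := (memLp_two_iff_integrable_sq hF.aestronglyMeasurable).2 hF2
  have hFi : Integrable F Q := hL2.integrable (by norm_num)
  have hd2 : MemLp (fun x => |1 - F x|) 2 Q := ((memLp_const (1 : ℝ)).sub hL2).abs
  have hdi : Integrable (fun x => 1 - F x) Q := (integrable_const _).sub hFi
  have hP : ((Q.withDensity fun x => ENNReal.ofReal (F x)) A).toReal = ∫ x in A, F x ∂Q := by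
    rw [withDensity_apply _ hA, integral_eq_lintegral_of_nonneg_ae (ae_of_all _ hF0)
      hF.aestronglyMeasurable]
  have hQ : (Q A).toReal = ∫ _ in A, (1 : ℝ) ∂Q := by simp [Measure.real]
  have hsq : ∫ x, |1 - F x| ^ 2 ∂Q = (∫ x, F x ^ 2 ∂Q) - 1 := by
    have h : ∀ x, |1 - F x| ^ 2 = 1 - 2 * F x + F x ^ 2 := fun x => by rw [sq_abs]; ring
    simp_rw [h]
    have hlin : Integrable (fun x => 1 - 2 * F x) Q := (integrable_const _).sub (hFi.const_mul 2)
    rw [integral_add hlin hF2, integral_sub (integrable_const _) (hFi.const_mul 2), integral_const_mul, hF1]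
    simp
    ring
  rw [hP, hQ, ← integral_sub (integrable_const _) hFi.integrableOn]
  calc |∫ x in A, (1 - F x) ∂Q| ≤ ∫ x in A, |1 - F x| ∂Q := abs_integral_le_integral_abs
    _ ≤ ∫ x, |1 - F x| ∂Q := setIntegral_le_integral hdi.abs (ae_of_all _ fun x => abs_nonneg _)
    _ ≤ √((∫ x, F x ^ 2 ∂Q) - 1) := by
      refine Real.le_sqrt_of_sq_le ?_
      have hvar := variance_eq_sub hd2
      have h0 := variance_nonneg (fun x => |1 - F x|) Q
      simp only [Pi.pow_apply] at hvar
      rw [hsq] at hvar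
      linarith

/-- Chi-square bound on the total variation distance between product measures. -/
theorem abs_sub_pi_withDensity_le (n : ℕ) (Q : Measure X) [IsProbabilityMeasure Q] {f : X → ℝ}
    (hf : Measurable f) (hf0 : ∀ x, 0 ≤ f x) (hf1 : ∫ x, f x ∂Q = 1)
    (hf2 : Integrable (fun x => f x ^ 2) Q) {A : Set (Fin n → X)} (hA : MeasurableSet A) :
    |((Measure.pi fun _ : Fin n => Q) A).toReal -
        ((Measure.pi fun _ : Fin n => Q.withDensity fun x => ENNReal.ofReal (f x)) A).toReal| ≤
      √((∫ x, f x ^ 2 ∂Q) ^ n - 1) := by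
  have hfi : Integrable f Q :=
    ((memLp_two_iff_integrable_sq hf.aestronglyMeasurable).2 hf2).integrable (by norm_num)
  have : IsProbabilityMeasure (Q.withDensity fun x => ENNReal.ofReal (f x)) := ⟨by
    rw [withDensity_apply _ MeasurableSet.univ, Measure.restrict_univ,
      ← ofReal_integral_eq_lintegral_ofReal hfi (ae_of_all _ hf0), hf1, ENNReal.ofReal_one]⟩
  have hpow : ∫ x : Fin n → X, (∏ i, f (x i)) ^ 2 ∂(Measure.pi fun _ => Q) =
      (∫ x, f x ^ 2 ∂Q) ^ n := by
    simp_rw [← Finset.prod_pow]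
    rw [integral_fintype_prod_eq_prod (fun _ x => f x ^ 2)]
    simp
  rw [pi_withDensity_eq Q hf0 hfi, ← hpow]
  refine abs_sub_withDensity_le _ (by fun_prop) (fun x => Finset.prod_nonneg fun i _ => hf0 _)
    ?_ ?_ hA
  · rw [integral_fintype_prod_eq_prod (fun _ => f)]
    simp [hf1]
  · simp_rw [← Finset.prod_pow]
    exact Integrable.fintype_prod (f := fun _ x => f x ^ 2) fun _ => hf2

end ChiSquareBound

section Gaussian

instance : IsProbabilityMeasure stdGauss := by unfold stdGauss; infer_instance

instance : IsProbabilityMeasure stdGauss2 := by unfold stdGauss2; infer_instance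

theorem biNormal_zero : biNormal 0 = stdGauss2 := by
  simp [biNormal]

theorem stdGauss_eq_withDensity :
    stdGauss = volume.withDensity fun y => ENNReal.ofReal (gaussianPDFReal 0 1 y) :=
  gaussianReal_of_var_ne_zero _ one_ne_zero

theorem stdGauss2_eq_withDensity :
    stdGauss2 = volume.withDensity fun z : ℝ × ℝ =>
      ENNReal.ofReal (gaussianPDFReal 0 1 z.1 * gaussianPDFReal 0 1 z.2) := by
  rw [stdGauss2, stdGauss_eq_withDensity, prod_withDensity (by fun_prop) (by fun_prop)]
  simp_rw [ENNReal.ofReal_mul (gaussianPDFReal_nonneg _ _ _)]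
  rfl

theorem stdGauss_withDensity_div (m : ℝ) {v : NNReal} (hv : v ≠ 0) :
    (stdGauss.withDensity fun y =>
      ENNReal.ofReal (gaussianPDFReal m v y / gaussianPDFReal 0 1 y)) = gaussianReal m v := by
  rw [stdGauss_eq_withDensity, ← withDensity_mul _ (by fun_prop) (by fun_prop),
    gaussianReal_of_var_ne_zero _ hv]
  congr 1
  ext y
  have := gaussianPDFReal_pos 0 1 y one_ne_zero
  rw [Pi.mul_apply, ← ENNReal.ofReal_mul this.le, mul_div_cancel₀ _ this.ne', gaussianPDF]

/-- The density of `biNormal ρ` with respect to `stdGauss2`. -/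
def biDensity (ρ : ℝ) (z : ℝ × ℝ) : ℝ :=
  gaussianPDFReal (ρ * z.1) (1 - ρ ^ 2).toNNReal z.2 / gaussianPDFReal 0 1 z.2

theorem measurable_biDensity (ρ : ℝ) : Measurable (biDensity ρ) := by
  unfold biDensity gaussianPDFReal
  fun_prop

theorem biDensity_nonneg (ρ : ℝ) (z : ℝ × ℝ) : 0 ≤ biDensity ρ z :=
  div_nonneg (gaussianPDFReal_nonneg _ _ _) (gaussianPDFReal_nonneg _ _ _)

theorem biNormal_eq_withDensity {ρ : ℝ} (hρ : ρ ^ 2 < 1) :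
    biNormal ρ = stdGauss2.withDensity fun z => ENNReal.ofReal (biDensity ρ z) := by
  have hv : (1 - ρ ^ 2).toNNReal ≠ 0 := by simpa using hρ
  have hT : Measurable fun z : ℝ × ℝ => (z.1, ρ * z.1 + √(1 - ρ ^ 2) * z.2) := by fun_prop
  have hg : Measurable fun z => ENNReal.ofReal (biDensity ρ z) :=
    (measurable_biDensity ρ).ennreal_ofReal
  ext s hs
  rw [biNormal, Measure.map_apply hT hs, withDensity_apply _ hs, ← lintegral_indicator hs,
    stdGauss2, Measure.prod_apply (hT hs), lintegral_prod _ (hg.indicator hs).aemeasurable]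
  refine lintegral_congr fun x => ?_
  have hsx : MeasurableSet (Prod.mk x ⁻¹' s) := measurable_prodMk_left hs
  have hmap : stdGauss.map (fun y => ρ * x + √(1 - ρ ^ 2) * y) =
      gaussianReal (ρ * x) (1 - ρ ^ 2).toNNReal := by
    have hcomp : (fun y => ρ * x + √(1 - ρ ^ 2) * y) =
        (fun y => ρ * x + y) ∘ fun y => √(1 - ρ ^ 2) * y := rfl
    rw [hcomp, ← Measure.map_map (by fun_prop) (by fun_prop), stdGauss,
      gaussianReal_map_const_mul, gaussianReal_map_const_add]
    congr 1
    · simp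
    · ext
      simp [Real.sq_sqrt (sub_nonneg.2 hρ.le), hρ.le]
  calc stdGauss (Prod.mk x ⁻¹' ((fun z : ℝ × ℝ => (z.1, ρ * z.1 + √(1 - ρ ^ 2) * z.2)) ⁻¹' s))
      = (stdGauss.map fun y => ρ * x + √(1 - ρ ^ 2) * y) (Prod.mk x ⁻¹' s) := by
        rw [Measure.map_apply (by fun_prop) hsx]
        rfl
    _ = ∫⁻ y in Prod.mk x ⁻¹' s, ENNReal.ofReal (biDensity ρ (x, y)) ∂stdGauss := by
        rw [hmap, ← stdGauss_withDensity_div _ hv, withDensity_apply _ hsx]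
        rfl
    _ = _ := by
        rw [← lintegral_indicator hsx]
        rfl

theorem biDensity_sq_mul {ρ : ℝ} (hρ : ρ ^ 2 < 1) (x y : ℝ) :
    gaussianPDFReal 0 1 x * gaussianPDFReal 0 1 y * biDensity ρ (x, y) ^ 2 =
      (1 - ρ ^ 2)⁻¹ * (gaussianPDFReal 0 ((1 + ρ ^ 2) / (1 - ρ ^ 2)).toNNReal x *
        gaussianPDFReal (2 * ρ * x / (1 + ρ ^ 2)) ((1 - ρ ^ 2) / (1 + ρ ^ 2)).toNNReal y) := by
  have ha : 0 < 1 - ρ ^ 2 := sub_pos.2 hρ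
  have hb : 0 < 1 + ρ ^ 2 := by positivity
  have hy := (gaussianPDFReal_pos 0 1 y one_ne_zero).ne'
  have hconst : ∀ t : ℝ, 0 < t → (√(2 * π * t))⁻¹ = (√(2 * π))⁻¹ * (√t)⁻¹ := fun t ht => by
    rw [Real.sqrt_mul (by positivity), mul_inv]
  have hone : gaussianPDFReal 0 1 y = (√(2 * π))⁻¹ * rexp (-y ^ 2 / 2) := by
    simp [gaussianPDFReal]
  have key : gaussianPDFReal 0 1 x * gaussianPDFReal (ρ * x) (1 - ρ ^ 2).toNNReal y ^ 2 =
      (1 - ρ ^ 2)⁻¹ * (gaussianPDFReal 0 ((1 + ρ ^ 2) / (1 - ρ ^ 2)).toNNReal x *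
        gaussianPDFReal (2 * ρ * x / (1 + ρ ^ 2)) ((1 - ρ ^ 2) / (1 + ρ ^ 2)).toNNReal y) *
        gaussianPDFReal 0 1 y := by
    rw [hone]
    simp only [gaussianPDFReal, Real.coe_toNNReal _ ha.le, Real.coe_toNNReal _ (div_pos ha hb).le,
      Real.coe_toNNReal _ (div_pos hb ha).le, NNReal.coe_one, hconst _ ha,
      hconst _ (div_pos ha hb), hconst _ (div_pos hb ha), hconst 1 one_pos, sub_zero]
    have hs : (√((1 + ρ ^ 2) / (1 - ρ ^ 2)))⁻¹ * (√((1 - ρ ^ 2) / (1 + ρ ^ 2)))⁻¹ = 1 := by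
      rw [← mul_inv, ← Real.sqrt_mul (by positivity)]
      rw [div_mul_div_cancel₀ ha.ne', div_self hb.ne']
      simp
    have hs2 : ((√(1 - ρ ^ 2))⁻¹) ^ 2 = (1 - ρ ^ 2)⁻¹ := by
      rw [inv_pow, Real.sq_sqrt ha.le]
    have he : rexp (-x ^ 2 / (2 * 1)) * rexp (-(y - ρ * x) ^ 2 / (2 * (1 - ρ ^ 2))) ^ 2 =
        rexp (-x ^ 2 / (2 * ((1 + ρ ^ 2) / (1 - ρ ^ 2)))) *
          rexp (-(y - 2 * ρ * x / (1 + ρ ^ 2)) ^ 2 / (2 * ((1 - ρ ^ 2) / (1 + ρ ^ 2)))) *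
          rexp (-y ^ 2 / 2) := by
      rw [sq (rexp _), ← Real.exp_add, ← Real.exp_add, ← Real.exp_add, ← Real.exp_add]
      congr 1
      field_simp
      ring
    generalize rexp (-x ^ 2 / (2 * 1)) = e1 at *
    generalize rexp (-(y - ρ * x) ^ 2 / (2 * (1 - ρ ^ 2))) = e2 at *
    generalize rexp (-x ^ 2 / (2 * ((1 + ρ ^ 2) / (1 - ρ ^ 2)))) = e3 at *
    generalize rexp (-(y - 2 * ρ * x / (1 + ρ ^ 2)) ^ 2 /
      (2 * ((1 - ρ ^ 2) / (1 + ρ ^ 2)))) = e4 at *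
    generalize rexp (-y ^ 2 / 2) = e5 at *
    generalize (√((1 + ρ ^ 2) / (1 - ρ ^ 2)))⁻¹ = s1 at *
    generalize (√((1 - ρ ^ 2) / (1 + ρ ^ 2)))⁻¹ = s2 at *
    generalize (√(1 - ρ ^ 2))⁻¹ = s3 at *
    generalize (√(2 * π))⁻¹ = c at *
    generalize (1 - ρ ^ 2)⁻¹ = d at *
    simp only [Real.sqrt_one, inv_one, mul_one]
    linear_combination c ^ 3 * s3 ^ 2 * he + c ^ 3 * e3 * e4 * e5 * hs2 -
      d * c ^ 3 * e3 * e4 * e5 * hs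
  unfold biDensity
  rw [div_pow]
  field_simp
  field_simp at key
  linear_combination key

theorem lintegral_biDensity_sq {ρ : ℝ} (hρ : ρ ^ 2 < 1) :
    ∫⁻ z, ENNReal.ofReal (biDensity ρ z ^ 2) ∂stdGauss2 = ENNReal.ofReal (1 - ρ ^ 2)⁻¹ := by
  have ha : 0 < 1 - ρ ^ 2 := sub_pos.2 hρ
  have hb : 0 < 1 + ρ ^ 2 := by positivity
  have hg := measurable_biDensity ρ
  have hnn := gaussianPDFReal_nonneg
  rw [stdGauss2_eq_withDensity, lintegral_withDensity_eq_lintegral_mul _ (by fun_prop)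
    (by fun_prop)]
  calc _ = ∫⁻ z : ℝ × ℝ, ENNReal.ofReal (1 - ρ ^ 2)⁻¹ *
        (gaussianPDF 0 ((1 + ρ ^ 2) / (1 - ρ ^ 2)).toNNReal z.1 *
          gaussianPDF (2 * ρ * z.1 / (1 + ρ ^ 2)) ((1 - ρ ^ 2) / (1 + ρ ^ 2)).toNNReal z.2) := by
        refine lintegral_congr fun z => ?_
        rw [Pi.mul_apply, ← ENNReal.ofReal_mul (mul_nonneg (hnn _ _ _) (hnn _ _ _)),
          biDensity_sq_mul hρ, ENNReal.ofReal_mul (inv_nonneg.2 ha.le),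
          ENNReal.ofReal_mul (hnn _ _ _)]
        rfl
    _ = ENNReal.ofReal (1 - ρ ^ 2)⁻¹ := by
        have hm : Measurable fun z : ℝ × ℝ =>
            gaussianPDF 0 ((1 + ρ ^ 2) / (1 - ρ ^ 2)).toNNReal z.1 *
            gaussianPDF (2 * ρ * z.1 / (1 + ρ ^ 2)) ((1 - ρ ^ 2) / (1 + ρ ^ 2)).toNNReal z.2 := by
          unfold gaussianPDF gaussianPDFReal
          fun_prop
        rw [lintegral_const_mul _ hm, Measure.volume_eq_prod, lintegral_prod _ hm.aemeasurable]
        simp only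
        have hv : ((1 - ρ ^ 2) / (1 + ρ ^ 2)).toNNReal ≠ 0 := by
          simpa using div_pos ha hb
        have hw : ((1 + ρ ^ 2) / (1 - ρ ^ 2)).toNNReal ≠ 0 := by
          simpa using div_pos hb ha
        simp_rw [lintegral_const_mul _ (measurable_gaussianPDF _ _),
          lintegral_gaussianPDF_eq_one _ hv, mul_one]
        rw [lintegral_gaussianPDF_eq_one _ hw, mul_one]

theorem integrable_biDensity_sq {ρ : ℝ} (hρ : ρ ^ 2 < 1) :
    Integrable (fun z => biDensity ρ z ^ 2) stdGauss2 := by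
  refine ⟨((measurable_biDensity ρ).pow_const 2).aestronglyMeasurable, ?_⟩
  rw [hasFiniteIntegral_iff_ofReal (ae_of_all _ fun z => sq_nonneg _), lintegral_biDensity_sq hρ]
  exact ENNReal.ofReal_lt_top

theorem integral_biDensity_sq {ρ : ℝ} (hρ : ρ ^ 2 < 1) :
    ∫ z, biDensity ρ z ^ 2 ∂stdGauss2 = (1 - ρ ^ 2)⁻¹ := by
  rw [integral_eq_lintegral_of_nonneg_ae (ae_of_all _ fun z => sq_nonneg _)
    ((measurable_biDensity ρ).pow_const 2).aestronglyMeasurable, lintegral_biDensity_sq hρ,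
    ENNReal.toReal_ofReal (inv_nonneg.2 (sub_pos.2 hρ).le)]

theorem integral_biDensity {ρ : ℝ} (hρ : ρ ^ 2 < 1) :
    ∫ z, biDensity ρ z ∂stdGauss2 = 1 := by
  have hprob : IsProbabilityMeasure (biNormal ρ) :=
    Measure.isProbabilityMeasure_map (by fun_prop)
  have h := hprob.measure_univ
  rw [biNormal_eq_withDensity hρ, withDensity_apply _ MeasurableSet.univ,
    Measure.restrict_univ] at h
  rw [integral_eq_lintegral_of_nonneg_ae (ae_of_all _ (biDensity_nonneg ρ))
    (measurable_biDensity ρ).aestronglyMeasurable, h, ENNReal.toReal_one]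

theorem mixture_eq_withDensity {ε ρ : ℝ} (hε0 : 0 ≤ ε) (hε1 : ε ≤ 1) (hρ : ρ ^ 2 < 1) :
    mixture ε ρ = stdGauss2.withDensity fun z =>
      ENNReal.ofReal ((1 - ε) + ε * biDensity ρ z) := by
  have hg := measurable_biDensity ρ
  have h : (fun z => ENNReal.ofReal ((1 - ε) + ε * biDensity ρ z)) =
      (fun _ => ENNReal.ofReal (1 - ε)) +
        ENNReal.ofReal ε • fun z => ENNReal.ofReal (biDensity ρ z) := by
    ext z
    rw [ENNReal.ofReal_add (sub_nonneg.2 hε1) (mul_nonneg hε0 (biDensity_nonneg ρ z)),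
      ENNReal.ofReal_mul hε0]
    rfl
  rw [h, withDensity_add_left measurable_const, withDensity_const,
    withDensity_smul _ hg.ennreal_ofReal, mixture, biNormal_zero, biNormal_eq_withDensity hρ]

theorem abs_sub_iid_mixture_le (n : ℕ) {ε ρ : ℝ} (hε0 : 0 ≤ ε) (hε1 : ε ≤ 1) (hρ : ρ ^ 2 < 1)
    {A : Set (Fin n → ℝ × ℝ)} (hA : MeasurableSet A) :
    |(iid n (biNormal 0) A).toReal - (iid n (mixture ε ρ) A).toReal| ≤
      √((1 + ε ^ 2 * (ρ ^ 2 / (1 - ρ ^ 2))) ^ n - 1) := by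
  have ha : 0 < 1 - ρ ^ 2 := sub_pos.2 hρ
  have hg := measurable_biDensity ρ
  have hi2 := integrable_biDensity_sq hρ
  have hi : Integrable (biDensity ρ) stdGauss2 :=
    ((memLp_two_iff_integrable_sq hg.aestronglyMeasurable).2 hi2).integrable (by norm_num)
  have hexp : (fun z => ((1 - ε) + ε * biDensity ρ z) ^ 2) = fun z =>
      ((1 - ε) ^ 2 + 2 * (1 - ε) * ε * biDensity ρ z) + ε ^ 2 * biDensity ρ z ^ 2 := by
    ext z
    ring
  have hint1 : Integrable (fun z => (1 - ε) ^ 2 + 2 * (1 - ε) * ε * biDensity ρ z) stdGauss2 :=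
    (integrable_const _).add (hi.const_mul _)
  have hval : ∫ z, ((1 - ε) + ε * biDensity ρ z) ^ 2 ∂stdGauss2 =
      1 + ε ^ 2 * (ρ ^ 2 / (1 - ρ ^ 2)) := by
    rw [hexp, integral_add hint1 (hi2.const_mul _),
      integral_add (integrable_const _) (hi.const_mul _), integral_const_mul, integral_const_mul,
      integral_biDensity hρ, integral_biDensity_sq hρ]
    simp
    field_simp
    ring
  rw [biNormal_zero, mixture_eq_withDensity hε0 hε1 hρ, ← hval]
  refine abs_sub_pi_withDensity_le n stdGauss2 (by fun_prop)
    (fun z => add_nonneg (sub_nonneg.2 hε1) (mul_nonneg hε0 (biDensity_nonneg ρ z))) ?_ ?_ hA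
  · rw [integral_add (integrable_const _) (hi.const_mul _), integral_const_mul,
      integral_biDensity hρ]
    simp
  · rw [hexp]
    exact hint1.add (hi2.const_mul _)

end Gaussian

theorem tendsto_sqrt_one_add_pow_sub_one {δ : ℕ → ℝ} (h0 : ∀ᶠ n in atTop, 0 ≤ δ n)
    (h : Tendsto (fun n : ℕ => n * δ n) atTop (𝓝 0)) :
    Tendsto (fun n : ℕ => √((1 + δ n) ^ n - 1)) atTop (𝓝 0) := by
  have hexp : Tendsto (fun n : ℕ => √(rexp (n * δ n) - 1)) atTop (𝓝 0) := by
    have := (((Real.continuous_exp.tendsto 0).comp h).sub_const 1).sqrt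
    simpa using this
  refine tendsto_of_tendsto_of_tendsto_of_le_of_le' tendsto_const_nhds hexp
    (Eventually.of_forall fun n => Real.sqrt_nonneg _) ?_
  filter_upwards [h0] with n hn
  refine Real.sqrt_le_sqrt (sub_le_sub_right ?_ 1)
  rw [Real.exp_nat_mul]
  exact pow_le_pow_left₀ (by positivity) (by linarith [Real.add_one_le_exp (δ n)]) n

theorem tendsto_natCast_mul_chiSq {β γ : ℝ} (hγ0 : 0 < γ) (hdense : 1 / 2 - β < γ) :
    Tendsto (fun n : ℕ => (n : ℝ) * (((n : ℝ) ^ (-β)) ^ 2 *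
      (((n : ℝ) ^ (-γ)) ^ 2 / (1 - ((n : ℝ) ^ (-γ)) ^ 2)))) atTop (𝓝 0) := by
  have hγ : Tendsto (fun n : ℕ => (n : ℝ) ^ (-γ)) atTop (𝓝 0) :=
    (tendsto_rpow_neg_atTop hγ0).comp tendsto_natCast_atTop_atTop
  have hnum : Tendsto (fun n : ℕ => (n : ℝ) ^ (-(2 * β + 2 * γ - 1))) atTop (𝓝 0) :=
    (tendsto_rpow_neg_atTop (by linarith)).comp tendsto_natCast_atTop_atTop
  have hden : Tendsto (fun n : ℕ => 1 - ((n : ℝ) ^ (-γ)) ^ 2) atTop (𝓝 1) := by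
    simpa using (hγ.pow 2).const_sub 1
  have hdiv := hnum.div hden one_ne_zero
  rw [zero_div] at hdiv
  refine hdiv.congr' ?_
  filter_upwards [eventually_gt_atTop 0] with n hn
  have hn' : (0 : ℝ) < n := Nat.cast_pos.2 hn
  have hpow : (n : ℝ) ^ (-(2 * β + 2 * γ - 1)) =
      n * ((n : ℝ) ^ (-β)) ^ 2 * ((n : ℝ) ^ (-γ)) ^ 2 := by
    rw [show -(2 * β + 2 * γ - 1) = 1 + (-β + -β) + (-γ + -γ) by ring, Real.rpow_add hn',
      Real.rpow_add hn', Real.rpow_add hn', Real.rpow_add hn', Real.rpow_one]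
    ring
  rw [Pi.div_apply, hpow]
  ring

/-- in the dense regime with `γ > 1/2 - β`, the total variation distance
between the `n`-fold products of the null and the alternative tends to 0, and every
sequence of tests (given by rejection regions `A n`) is asymptotically powerless. -/
theorem dense_regime_LRT_powerless (β γ : ℝ) (hβ0 : 0 < β) (hβ1 : β < 1) (hγ0 : 0 < γ)
    (hdense : 1 / 2 - β < γ)
    (ε ρ : ℕ → ℝ) (hε : ∀ n : ℕ, ε n = (n : ℝ) ^ (-β)) (hρ : ∀ n : ℕ, ρ n = (n : ℝ) ^ (-γ)) :
    Tendsto (fun n => tvDist (iid n (biNormal 0)) (iid n (mixture (ε n) (ρ n)))) atTop (𝓝 0)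
    ∧ ∀ A : (n : ℕ) → Set (Fin n → ℝ × ℝ), (∀ n, MeasurableSet (A n)) →
        1 ≤ Filter.liminf (fun n =>
          ((iid n (biNormal 0)) (A n)).toReal
            + (1 - ((iid n (mixture (ε n) (ρ n))) (A n)).toReal)) atTop := by
  set B : ℕ → ℝ := fun n => √((1 + ε n ^ 2 * (ρ n ^ 2 / (1 - ρ n ^ 2))) ^ n - 1)
  have hρ1 : ∀ᶠ n in atTop, ρ n ^ 2 < 1 := by
    have hγ : Tendsto ρ atTop (𝓝 0) := by
      rw [funext hρ]
      exact (tendsto_rpow_neg_atTop hγ0).comp tendsto_natCast_atTop_atTop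
    have := hγ.pow 2
    exact this.eventually_lt_const (by norm_num)
  have hε01 : ∀ᶠ n in atTop, 0 ≤ ε n ∧ ε n ≤ 1 := by
    filter_upwards [eventually_ge_atTop 1] with n hn
    rw [hε]
    exact ⟨by positivity, Real.rpow_le_one_of_one_le_of_nonpos (by exact_mod_cast hn)
      (by linarith)⟩
  have hB : Tendsto B atTop (𝓝 0) := by
    refine tendsto_sqrt_one_add_pow_sub_one ?_ ?_
    · filter_upwards [hρ1] with n hn
      exact mul_nonneg (sq_nonneg _) (div_nonneg (sq_nonneg _) (sub_pos.2 hn).le)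
    · simp_rw [hε, hρ]
      exact tendsto_natCast_mul_chiSq hγ0 hdense
  have hbound : ∀ᶠ n in atTop, ∀ A : Set (Fin n → ℝ × ℝ), MeasurableSet A →
      |(iid n (biNormal 0) A).toReal - (iid n (mixture (ε n) (ρ n)) A).toReal| ≤ B n := by
    filter_upwards [hρ1, hε01] with n h1 h2 A hA
    exact abs_sub_iid_mixture_le n h2.1 h2.2 h1 hA
  refine ⟨?_, fun A hA => ?_⟩
  · refine tendsto_of_tendsto_of_tendsto_of_le_of_le' tendsto_const_nhds hB
      (Eventually.of_forall fun n => Real.iSup_nonneg fun s => abs_nonneg _) ?_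
    filter_upwards [hbound] with n hn
    have : Nonempty {s : Set (Fin n → ℝ × ℝ) // MeasurableSet s} := ⟨⟨∅, MeasurableSet.empty⟩⟩
    exact ciSup_le fun s => hn s.1 s.2
  · have hdiff : Tendsto (fun n => (iid n (biNormal 0) (A n)).toReal -
        (iid n (mixture (ε n) (ρ n)) (A n)).toReal) atTop (𝓝 0) :=
      squeeze_zero_norm' (by filter_upwards [hbound] with n hn using hn (A n) (hA n)) hB
    have hlim : Tendsto (fun n => (iid n (biNormal 0) (A n)).toReal +
        (1 - (iid n (mixture (ε n) (ρ n)) (A n)).toReal)) atTop (𝓝 1) := by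
      have := hdiff.const_add 1
      rw [add_zero] at this
      exact this.congr fun n => by ring
    exact hlim.liminf_eq.ge
end
end

section
/- In the dense regime, the covariance test achieves the detection boundary: if ε_n = n^{-β} and ρ_n = n^{-γ} with β, γ > 0 fixed such that γ < 1/2 − β, then the sequence of tests that, given n i.i.d. observations (X₁,Y₁),…,(Xₙ,Yₙ), rejects when T_n := Σ_{i=1}^n X_i Y_i ≥ √n · log n, is asymptotically powerful. -/
open MeasureTheory ProbabilityTheory Real Filter Topology

noncomputable section

lemma integrable_pow_stdGauss (k : ℕ) : Integrable (fun x : ℝ => x ^ k) stdGauss := by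
  rcases Nat.eq_zero_or_pos k with rfl | hk
  · have : IsProbabilityMeasure stdGauss := by unfold stdGauss; infer_instance
    simp
  · have h := (memLp_id_gaussianReal (μ := 0) (v := 1) k).integrable_norm_pow hk.ne'
    refine h.mono' (by fun_prop) (ae_of_all _ fun x => ?_)
    simp

instance isProbabilityMeasure_stdGauss : IsProbabilityMeasure stdGauss := by
  unfold stdGauss; infer_instance

instance isProbabilityMeasure_stdGauss2 : IsProbabilityMeasure stdGauss2 := by
  unfold stdGauss2; infer_instance

instance isProbabilityMeasure_biNormal (ρ : ℝ) : IsProbabilityMeasure (biNormal ρ) :=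
  Measure.isProbabilityMeasure_map (by fun_prop)

lemma integrable_monomial_stdGauss2 (a b : ℕ) :
    Integrable (fun z : ℝ × ℝ => z.1 ^ a * z.2 ^ b) stdGauss2 :=
  (integrable_pow_stdGauss a).mul_prod (integrable_pow_stdGauss b)

lemma integral_id_stdGauss : ∫ x, x ∂stdGauss = 0 := integral_id_gaussianReal

lemma integral_sq_stdGauss : ∫ x, x ^ 2 ∂stdGauss = 1 := by
  have h := variance_eq_sub (memLp_id_gaussianReal (μ := 0) (v := 1) 2)
  rw [variance_id_gaussianReal] at h
  simp only [Pi.pow_apply, id_eq, integral_id_gaussianReal] at h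
  unfold stdGauss
  simpa using h.symm

/-- A bound, uniform in the correlation, for the second moment of `XY` under `biNormal`. -/
def momentBound : ℝ :=
  ∫ z, (2 * (z.1 ^ 4 * z.2 ^ 0) + 2 * (z.1 ^ 2 * z.2 ^ 2)) ∂stdGauss2

lemma integrable_momentBound :
    Integrable (fun z : ℝ × ℝ => 2 * (z.1 ^ 4 * z.2 ^ 0) + 2 * (z.1 ^ 2 * z.2 ^ 2)) stdGauss2 :=
  ((integrable_monomial_stdGauss2 4 0).const_mul 2).add
    ((integrable_monomial_stdGauss2 2 2).const_mul 2)

lemma sq_mul_corr_le {ρ : ℝ} (h0 : 0 ≤ ρ) (h1 : ρ ≤ 1) (a b : ℝ) :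
    (a * (ρ * a + √(1 - ρ ^ 2) * b)) ^ 2
      ≤ 2 * (a ^ 4 * b ^ 0) + 2 * (a ^ 2 * b ^ 2) := by
  have hρ : 0 ≤ 1 - ρ ^ 2 := by nlinarith
  have hs : √(1 - ρ ^ 2) ^ 2 = 1 - ρ ^ 2 := Real.sq_sqrt hρ
  set s := √(1 - ρ ^ 2)
  have h2 : (ρ * a + s * b) ^ 2 ≤ 2 * a ^ 2 + 2 * b ^ 2 := by
    have : (ρ * a + s * b) ^ 2 ≤ 2 * (ρ ^ 2 * a ^ 2) + 2 * (s ^ 2 * b ^ 2) := by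
      nlinarith [sq_nonneg (ρ * a - s * b)]
    rw [hs] at this
    nlinarith [mul_nonneg hρ (sq_nonneg a), mul_nonneg (sq_nonneg ρ) (sq_nonneg b)]
  calc (a * (ρ * a + s * b)) ^ 2 = a ^ 2 * (ρ * a + s * b) ^ 2 := by ring
    _ ≤ a ^ 2 * (2 * a ^ 2 + 2 * b ^ 2) := by gcongr
    _ = _ := by ring

lemma integrable_sq_biNormal {ρ : ℝ} (h0 : 0 ≤ ρ) (h1 : ρ ≤ 1) :
    Integrable (fun z : ℝ × ℝ => (z.1 * z.2) ^ 2) (biNormal ρ) := by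
  unfold biNormal
  rw [integrable_map_measure (by fun_prop) (by fun_prop)]
  refine integrable_momentBound.mono' (by fun_prop) (ae_of_all _ fun z => ?_)
  simp only [Function.comp_apply]
  rw [Real.norm_of_nonneg (sq_nonneg _)]
  exact sq_mul_corr_le h0 h1 z.1 z.2

lemma integral_sq_biNormal_le {ρ : ℝ} (h0 : 0 ≤ ρ) (h1 : ρ ≤ 1) :
    ∫ z, (z.1 * z.2) ^ 2 ∂biNormal ρ ≤ momentBound := by
  unfold biNormal
  rw [integral_map (by fun_prop) (by fun_prop)]
  exact integral_mono_of_nonneg (ae_of_all _ fun z => sq_nonneg _) integrable_momentBound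
    (ae_of_all _ fun z => sq_mul_corr_le h0 h1 z.1 z.2)

lemma integral_mul_biNormal (ρ : ℝ) : ∫ z, z.1 * z.2 ∂biNormal ρ = ρ := by
  unfold biNormal
  rw [integral_map (by fun_prop) (by fun_prop)]
  have h (z : ℝ × ℝ) : z.1 * (ρ * z.1 + √(1 - ρ ^ 2) * z.2)
      = ρ * (z.1 ^ 2 * z.2 ^ 0) + √(1 - ρ ^ 2) * (z.1 ^ 1 * z.2 ^ 1) := by ring
  simp only [h]
  rw [integral_add ((integrable_monomial_stdGauss2 2 0).const_mul _)
    ((integrable_monomial_stdGauss2 1 1).const_mul _), integral_const_mul, integral_const_mul]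
  unfold stdGauss2
  rw [integral_prod_mul (fun x : ℝ => x ^ 2) (fun x : ℝ => x ^ 0),
    integral_prod_mul (fun x : ℝ => x ^ 1) (fun x : ℝ => x ^ 1)]
  simp [integral_sq_stdGauss, integral_id_stdGauss]

lemma memLp_mul_of_integrable_sq {μ : Measure (ℝ × ℝ)}
    (h : Integrable (fun z : ℝ × ℝ => (z.1 * z.2) ^ 2) μ) :
    MemLp (fun z : ℝ × ℝ => z.1 * z.2) 2 μ :=
  (memLp_two_iff_integrable_sq (by fun_prop)).2 h

lemma isProbabilityMeasure_mixture {ε : ℝ} (h0 : 0 ≤ ε) (h1 : ε ≤ 1) (ρ : ℝ) :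
    IsProbabilityMeasure (mixture ε ρ) := by
  constructor
  simp only [mixture, Measure.add_apply, Measure.smul_apply, measure_univ, smul_eq_mul, mul_one]
  rw [← ENNReal.ofReal_add (by linarith) h0]
  simp

lemma integral_mixture {ε : ℝ} (h0 : 0 ≤ ε) (h1 : ε ≤ 1) (ρ : ℝ) {f : ℝ × ℝ → ℝ}
    (hf0 : Integrable f (biNormal 0)) (hf : Integrable f (biNormal ρ)) :
    ∫ z, f z ∂mixture ε ρ = (1 - ε) * ∫ z, f z ∂biNormal 0 + ε * ∫ z, f z ∂biNormal ρ := by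
  unfold mixture
  rw [integral_add_measure (hf0.smul_measure ENNReal.ofReal_ne_top)
    (hf.smul_measure ENNReal.ofReal_ne_top), integral_smul_measure, integral_smul_measure,
    ENNReal.toReal_ofReal (by linarith), ENNReal.toReal_ofReal h0]
  simp

lemma integrable_sq_mixture {ε ρ : ℝ} (r0 : 0 ≤ ρ) (r1 : ρ ≤ 1) :
    Integrable (fun z : ℝ × ℝ => (z.1 * z.2) ^ 2) (mixture ε ρ) :=
  ((integrable_sq_biNormal le_rfl zero_le_one).smul_measure ENNReal.ofReal_ne_top).add_measure
    ((integrable_sq_biNormal r0 r1).smul_measure ENNReal.ofReal_ne_top)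

lemma integral_sq_mixture_le {ε ρ : ℝ} (h0 : 0 ≤ ε) (h1 : ε ≤ 1) (r0 : 0 ≤ ρ) (r1 : ρ ≤ 1) :
    ∫ z, (z.1 * z.2) ^ 2 ∂mixture ε ρ ≤ momentBound := by
  rw [integral_mixture h0 h1 ρ (integrable_sq_biNormal le_rfl zero_le_one)
    (integrable_sq_biNormal r0 r1)]
  have hb0 := mul_le_mul_of_nonneg_left (integral_sq_biNormal_le le_rfl zero_le_one)
    (sub_nonneg.2 h1)
  have hb := mul_le_mul_of_nonneg_left (integral_sq_biNormal_le r0 r1) h0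
  linarith

lemma integral_mul_mixture {ε ρ : ℝ} (h0 : 0 ≤ ε) (h1 : ε ≤ 1) (r0 : 0 ≤ ρ) (r1 : ρ ≤ 1) :
    ∫ z, z.1 * z.2 ∂mixture ε ρ = ε * ρ := by
  rw [integral_mixture h0 h1 ρ
    ((memLp_mul_of_integrable_sq (integrable_sq_biNormal le_rfl zero_le_one)).integrable
      one_le_two)
    ((memLp_mul_of_integrable_sq (integrable_sq_biNormal r0 r1)).integrable one_le_two),
    integral_mul_biNormal, integral_mul_biNormal]
  ring

/-- Chebyshev's inequality for the covariance statistic. -/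
lemma iid_deviation_le (n : ℕ) {μ : Measure (ℝ × ℝ)} [IsProbabilityMeasure μ] {B c : ℝ}
    (h : Integrable (fun z : ℝ × ℝ => (z.1 * z.2) ^ 2) μ)
    (hB : ∫ z, (z.1 * z.2) ^ 2 ∂μ ≤ B) (hc : 0 < c) :
    (iid n μ).real {x | c ≤ |∑ i, (x i).1 * (x i).2 - n * ∫ z, z.1 * z.2 ∂μ|}
      ≤ n * B / c ^ 2 := by
  have : IsProbabilityMeasure (iid n μ) := by unfold iid; infer_instance
  have hL := memLp_mul_of_integrable_sq h
  have hLi (i : Fin n) : MemLp (fun x : Fin n → ℝ × ℝ => (x i).1 * (x i).2) 2 (iid n μ) :=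
    hL.comp_measurePreserving (measurePreserving_eval (fun _ => μ) i)
  have hLs : MemLp (fun x : Fin n → ℝ × ℝ => ∑ i, (x i).1 * (x i).2) 2 (iid n μ) :=
    memLp_finsetSum _ fun i _ => hLi i
  have hmean : ∫ x, ∑ i, (x i).1 * (x i).2 ∂iid n μ = n * ∫ z, z.1 * z.2 ∂μ := by
    rw [integral_finsetSum _ fun i _ => (hLi i).integrable one_le_two]
    have (i : Fin n) : ∫ x, (x i).1 * (x i).2 ∂iid n μ = ∫ z, z.1 * z.2 ∂μ :=
      integral_comp_eval (μ := fun _ : Fin n => μ) (i := i) (f := fun z => z.1 * z.2) hL.1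
    simp [this]
  have hvar : Var[fun x : Fin n → ℝ × ℝ => ∑ i, (x i).1 * (x i).2; iid n μ] ≤ n * B := by
    have hsum := variance_sum_pi (μ := fun _ : Fin n => μ)
      (X := fun _ z => z.1 * z.2) fun _ => hL
    have heq : (∑ i, fun x : Fin n → ℝ × ℝ => (x i).1 * (x i).2)
        = fun x => ∑ i, (x i).1 * (x i).2 := by ext x; simp
    rw [heq] at hsum
    unfold iid
    rw [hsum]
    have := (variance_le_expectation_sq hL.1).trans hB
    simpa using mul_le_mul_of_nonneg_left this n.cast_nonneg
  have hcheb := meas_ge_le_variance_div_sq hLs hc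
  rw [hmean] at hcheb
  have := ENNReal.toReal_le_of_le_ofReal (div_nonneg (variance_nonneg _ _) (sq_nonneg c)) hcheb
  refine this.trans ?_
  gcongr

/-- in the dense regime with `γ < 1/2 - β`, the covariance test rejecting
when `Tₙ = Σᵢ XᵢYᵢ ≥ √n log n` is asymptotically powerful: the sum of its type I and
type II error probabilities tends to 0. -/
theorem covariance_test_dense_powerful (β γ : ℝ) (hβ0 : 0 < β) (hγ0 : 0 < γ)
    (hdense : γ < 1 / 2 - β)
    (ε ρ : ℕ → ℝ) (hε : ∀ n : ℕ, ε n = (n : ℝ) ^ (-β)) (hρ : ∀ n : ℕ, ρ n = (n : ℝ) ^ (-γ)) :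
    Tendsto (fun n =>
      ((iid n (biNormal 0))
          {x : Fin n → ℝ × ℝ | Real.sqrt n * Real.log n ≤ ∑ i, (x i).1 * (x i).2}).toReal
        + (1 - ((iid n (mixture (ε n) (ρ n)))
          {x : Fin n → ℝ × ℝ | Real.sqrt n * Real.log n ≤ ∑ i, (x i).1 * (x i).2}).toReal))
      atTop (𝓝 0) := by
  have hB : 0 ≤ momentBound := integral_nonneg fun z => by positivity
  have hlog : Tendsto (fun n : ℕ => Real.log n) atTop atTop :=
    Real.tendsto_log_atTop.comp tendsto_natCast_atTop_atTop
  have hlim : Tendsto (fun n : ℕ => 2 * (momentBound / Real.log n ^ 2)) atTop (𝓝 0) := by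
    simpa using (((tendsto_pow_atTop two_ne_zero).comp hlog).const_div_atTop
      momentBound).const_mul 2
  have hsep : ∀ᶠ n : ℕ in atTop, 2 * (√n * Real.log n) ≤ n * (ε n * ρ n) := by
    have ho := ((isLittleO_log_rpow_atTop (r := 1 / 2 - β - γ) (by linarith)).bound
      (show (0 : ℝ) < 1 / 2 by norm_num))
    filter_upwards [tendsto_natCast_atTop_atTop.eventually ho, eventually_ge_atTop 1] with n hn h1
    have hn0 : (0 : ℝ) < n := by exact_mod_cast h1
    rw [Real.norm_of_nonneg (Real.rpow_nonneg hn0.le _)] at hn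
    have hl : 2 * Real.log n ≤ (n : ℝ) ^ (1 / 2 - β - γ) := by
      linarith [Real.le_norm_self (Real.log n)]
    have heq : (n : ℝ) * (ε n * ρ n) = √n * (n : ℝ) ^ (1 / 2 - β - γ) := by
      rw [hε, hρ, Real.sqrt_eq_rpow, ← Real.rpow_add hn0, ← Real.rpow_add hn0]
      nth_rewrite 1 [← Real.rpow_one (n : ℝ)]
      rw [← Real.rpow_add hn0]
      ring_nf
    rw [heq]
    nlinarith [Real.sqrt_nonneg (n : ℝ)]
  have hprob (n : ℕ) (μ : Measure (ℝ × ℝ)) [IsProbabilityMeasure μ] :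
      IsProbabilityMeasure (iid n μ) := by unfold iid; infer_instance
  have hbounds : ∀ᶠ n : ℕ in atTop,
      0 ≤ ε n ∧ ε n ≤ 1 ∧ 0 ≤ ρ n ∧ ρ n ≤ 1 := by
    filter_upwards [eventually_ge_atTop 1] with n h1
    have hn : (1 : ℝ) ≤ n := by exact_mod_cast h1
    rw [hε, hρ]
    exact ⟨by positivity, Real.rpow_le_one_of_one_le_of_nonpos hn (by linarith), by positivity,
      Real.rpow_le_one_of_one_le_of_nonpos hn (by linarith)⟩
  refine tendsto_of_tendsto_of_tendsto_of_le_of_le' tendsto_const_nhds hlim ?_ ?_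
  · filter_upwards [hbounds] with n hb
    have := isProbabilityMeasure_mixture hb.1 hb.2.1 (ρ n)
    have := hprob n (mixture (ε n) (ρ n))
    exact add_nonneg ENNReal.toReal_nonneg (sub_nonneg.2 measureReal_le_one)
  · filter_upwards [hbounds, hsep, eventually_ge_atTop 1, hlog.eventually_gt_atTop 0]
      with n hb hs hn1 hl
    obtain ⟨h0, h1, r0, r1⟩ := hb
    have := isProbabilityMeasure_mixture h0 h1 (ρ n)
    have := hprob n (mixture (ε n) (ρ n))
    have := hprob n (biNormal 0)
    have hn0 : (0 : ℝ) < n := by exact_mod_cast hn1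
    have hc : 0 < √n * Real.log n := by positivity
    have hval : n * momentBound / (√n * Real.log n) ^ 2 = momentBound / Real.log n ^ 2 := by
      rw [mul_pow, Real.sq_sqrt hn0.le]
      field_simp
    have hnull := iid_deviation_le n (integrable_sq_biNormal le_rfl zero_le_one)
      (integral_sq_biNormal_le le_rfl zero_le_one) hc
    have halt := iid_deviation_le n (integrable_sq_mixture (ε := ε n) r0 r1)
      (integral_sq_mixture_le h0 h1 r0 r1) hc
    rw [hval, integral_mul_biNormal] at hnull
    rw [hval, integral_mul_mixture h0 h1 r0 r1] at halt
    set A := {x : Fin n → ℝ × ℝ | √n * Real.log n ≤ ∑ i, (x i).1 * (x i).2} with hA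
    have hAm : MeasurableSet A := measurableSet_le (by fun_prop) (by fun_prop)
    have htypeI : (iid n (biNormal 0)).real A ≤ momentBound / Real.log n ^ 2 := by
      refine (measureReal_mono fun x hx => ?_).trans hnull
      simp only [hA, Set.mem_ofPred_eq, mul_zero, sub_zero] at hx ⊢
      exact hx.trans (le_abs_self _)
    have htypeII : (iid n (mixture (ε n) (ρ n))).real Aᶜ ≤ momentBound / Real.log n ^ 2 := by
      refine (measureReal_mono fun x hx => ?_).trans halt
      simp only [hA, Set.mem_compl_iff, Set.mem_ofPred_eq, not_le] at hx ⊢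
      rw [abs_sub_comm]
      refine le_trans ?_ (le_abs_self _)
      linarith
    rw [probReal_compl_eq_one_sub hAm] at htypeII
    simp only [measureReal_def] at htypeI htypeII
    linarith
end
end
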